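/- There exists η₀>0 such that for every fixed η∈(0,η₀), with probability tending to 1 as n → ∞, a random graph G ~ G(n,1/2) has the following property: for every bisection A∪B of G, we have |Δ_{A,B}(v)| ≥ 4^{−1/η}√n for all but at most ηn vertices v∈A, and |Δ_{A,B}(v)| ≥ 4^{−1/η}√n for all but at most ηn vertices v∈B. -/

import Mathlib

open Finset Filter

open scoped Classical

/-- The number of neighbours of `v` (in the graph `G`) lying in the set `S`. -/
noncomputable def degIn {n : ℕ} (G : SimpleGraph (Fin n)) (S : Finset (Fin n)) (v : Fin n) : ℕ :=
  (S.filter fun w => G.Adj v w).card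

/-- The friendliness of a vertex `v` with respect to the bisection `A ∪ Aᶜ`:
the number of neighbours in its own part minus the number of neighbours across. -/
noncomputable def friendliness {n : ℕ} (G : SimpleGraph (Fin n)) (A : Finset (Fin n))
    (v : Fin n) : ℤ :=
  if v ∈ A then (degIn G A v : ℤ) - (degIn G Aᶜ v : ℤ)
  else (degIn G Aᶜ v : ℤ) - (degIn G A v : ℤ)

/-- `A ∪ Aᶜ` is a bisection: the parts' sizes differ by at most one. -/
def IsBisection {n : ℕ} (A : Finset (Fin n)) : Prop :=
  |(A.card : ℤ) - (Aᶜ.card : ℤ)| ≤ 1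

/-- The probability, under the uniform measure on simple graphs on `Fin n`
(i.e. the Erdős–Rényi measure `G(n,1/2)`), of the set of graphs satisfying `P`. -/
noncomputable def graphProb (n : ℕ) (P : SimpleGraph (Fin n) → Prop) : ℝ :=
  ((univ.filter P).card : ℝ) / (Fintype.card (SimpleGraph (Fin n)) : ℝ)

open scoped symmDiff

theorem succ_mul_centralBinom_sq_le (k : ℕ) : (2 * k + 1) * k.centralBinom ^ 2 ≤ 16 ^ k := by
  induction k with
  | zero => simp
  | succ k ih =>
    have h := Nat.succ_mul_centralBinom_succ k
    have h2 : (k + 1) ^ 2 * ((2 * (k + 1) + 1) * (k + 1).centralBinom ^ 2) ≤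
        (k + 1) ^ 2 * 16 ^ (k + 1) := by
      calc (k + 1) ^ 2 * ((2 * (k + 1) + 1) * (k + 1).centralBinom ^ 2)
          = (2 * k + 3) * ((k + 1) * (k + 1).centralBinom) ^ 2 := by ring
        _ = 4 * ((2 * k + 3) * (2 * k + 1)) * ((2 * k + 1) * k.centralBinom ^ 2) := by
            rw [h]; ring
        _ ≤ 4 * (4 * (k + 1) ^ 2) * 16 ^ k := by
            refine Nat.mul_le_mul (Nat.mul_le_mul_left _ ?_) ih
            nlinarith
        _ = (k + 1) ^ 2 * 16 ^ (k + 1) := by ring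
    exact Nat.le_of_mul_le_mul_left h2 (by positivity)

theorem succ_mul_choose_sq_le (m j : ℕ) : (m + 1) * m.choose j ^ 2 ≤ 4 ^ m := by
  have hj : m.choose j ≤ m.choose (m / 2) := Nat.choose_le_middle j m
  refine (Nat.mul_le_mul_left _ (Nat.pow_le_pow_left hj 2)).trans ?_
  obtain ⟨k, rfl | rfl⟩ := Nat.even_or_odd' m
  · have h := succ_mul_centralBinom_sq_le k
    rw [Nat.centralBinom_eq_two_mul_choose] at h
    rw [Nat.mul_div_cancel_left k two_pos, pow_mul]
    exact h
  · have h := succ_mul_centralBinom_sq_le (k + 1)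
    have hc : (k + 1).centralBinom = 2 * (2 * k + 1).choose k := by
      rw [Nat.centralBinom_eq_two_mul_choose, show 2 * (k + 1) = (2 * k + 1) + 1 by ring,
        Nat.choose_succ_succ, ← Nat.choose_symm_half k]
      ring
    rw [hc] at h
    rw [show (2 * k + 1) / 2 = k by omega]
    have h4 : 16 ^ (k + 1) = 4 * 4 ^ (2 * k + 1) := by
      rw [show (16 : ℕ) = 4 ^ 2 by norm_num, ← pow_mul, ← pow_succ']
      ring_nf
    nlinarith [sq_nonneg ((2 * k + 1).choose k)]

theorem choose_mul_sqrt_le (m j : ℕ) : (m.choose j : ℝ) * √(m + 1 : ℝ) ≤ 2 ^ m := by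
  have h : ((m + 1 : ℝ)) * (m.choose j : ℝ) ^ 2 ≤ 4 ^ m := by
    exact_mod_cast succ_mul_choose_sq_le m j
  refine abs_le_of_sq_le_sq' ?_ (by positivity) |>.2
  rw [mul_pow, Real.sq_sqrt (by positivity), ← pow_mul, mul_comm m 2, pow_mul]
  norm_num
  linarith

/-- An open interval of length `2 * L` contains at most `2 * L + 1` natural numbers. -/
theorem card_filter_abs_sub_lt_le (s : Finset ℕ) (c L : ℝ) (hL : 0 ≤ L) :
    ((s.filter fun j : ℕ => |(j : ℝ) - c| < L).card : ℝ) ≤ 2 * L + 1 := by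
  have h1 : (s.filter fun j : ℕ => |(j : ℝ) - c| < L).card ≤
      (Finset.Icc ⌈c - L⌉ ⌊c + L⌋).card := by
    refine Finset.card_le_card_of_injOn (fun j : ℕ => (j : ℤ)) ?_ (Nat.cast_injective.injOn)
    intro j hj
    have hj2 := abs_lt.1 (Finset.mem_filter.1 hj).2
    simp only [Finset.coe_Icc, Set.mem_Icc, Int.ceil_le, Int.le_floor, Int.cast_natCast]
    constructor <;> linarith
  have h2 : ((Finset.Icc ⌈c - L⌉ ⌊c + L⌋).card : ℝ) ≤ 2 * L + 1 := by
    rw [Int.card_Icc]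
    have h3 : (((⌊c + L⌋ + 1 - ⌈c - L⌉).toNat : ℤ) : ℝ) =
        ((max (⌊c + L⌋ + 1 - ⌈c - L⌉) 0 : ℤ) : ℝ) := by
      rw [Int.toNat_eq_max]
    rw [Int.cast_natCast] at h3
    rw [h3, Int.cast_max]
    push_cast
    refine max_le ?_ (by linarith)
    linarith [Int.floor_le (c + L), Int.le_ceil (c - L)]
  exact (Nat.cast_le.2 h1).trans h2

/-- Anticoncentration of the size of `X ∆ U` for a uniformly random subset `U` of `T`. -/
theorem card_filter_symmDiff_le {α : Type*} [DecidableEq α] (T X : Finset α) (c L : ℝ)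
    (hL : 1 ≤ L) :
    ((T.powerset.filter fun U => |((X ∆ U).card : ℝ) - c| < L).card : ℝ) * √(T.card + 1 : ℝ) ≤
      3 * L * 2 ^ T.card := by
  set J := (Finset.range (T.card + 1)).filter
    fun j : ℕ => |(j : ℝ) - (c - (X \ T).card)| < L with hJ
  have hsplit : ∀ U ⊆ T, (X ∆ U).card = ((X ∩ T) ∆ U).card + (X \ T).card := by
    intro U hU
    rw [← Finset.card_union_of_disjoint]
    · congr 1
      ext a
      have := @hU a
      simp only [Finset.mem_symmDiff, Finset.mem_union, Finset.mem_inter, Finset.mem_sdiff]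
      tauto
    · rw [Finset.disjoint_left]
      intro a
      have := @hU a
      simp only [Finset.mem_symmDiff, Finset.mem_inter, Finset.mem_sdiff]
      tauto
  have h1 : (T.powerset.filter fun U => |((X ∆ U).card : ℝ) - c| < L).card ≤
      (J.biUnion fun j => T.powersetCard j).card := by
    refine Finset.card_le_card_of_injOn (fun U => (X ∩ T) ∆ U) ?_
      ((symmDiff_right_injective (X ∩ T)).injOn)
    intro U hU
    obtain ⟨hUT, hUc⟩ := Finset.mem_filter.1 hU
    rw [Finset.mem_powerset] at hUT
    have hsub : (X ∩ T) ∆ U ⊆ T := by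
      intro a
      have := @hUT a
      simp only [Finset.mem_symmDiff, Finset.mem_inter]
      tauto
    simp only [Finset.mem_coe, Finset.mem_biUnion, Finset.mem_powersetCard]
    refine ⟨_, ?_, hsub, rfl⟩
    rw [hJ, Finset.mem_filter, Finset.mem_range]
    refine ⟨Nat.lt_succ_of_le (Finset.card_le_card hsub), ?_⟩
    rw [hsplit U hUT] at hUc
    push_cast at hUc
    convert hUc using 2
    ring
  have h2 : (J.biUnion fun j => T.powersetCard j).card ≤ ∑ j ∈ J, T.card.choose j := by
    refine Finset.card_biUnion_le.trans_eq ?_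
    simp
  have h3 : (J.card : ℝ) ≤ 3 * L :=
    (card_filter_abs_sub_lt_le _ _ L (by linarith)).trans (by linarith)
  calc _ ≤ ((∑ j ∈ J, T.card.choose j : ℕ) : ℝ) * √(T.card + 1 : ℝ) := by
        gcongr
        exact h1.trans h2
    _ = ∑ j ∈ J, (T.card.choose j : ℝ) * √(T.card + 1 : ℝ) := by
        rw [Nat.cast_sum, Finset.sum_mul]
    _ ≤ ∑ _j ∈ J, (2 : ℝ) ^ T.card := Finset.sum_le_sum fun j _ => choose_mul_sqrt_le _ j
    _ = J.card * (2 : ℝ) ^ T.card := by simp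
    _ ≤ 3 * L * 2 ^ T.card := by gcongr

/-- If among the perturbations `G ∆ H f` of every graph `G` at most `B` satisfy `P`, then the
proportion of graphs satisfying `P` is at most `B / #F`. -/
theorem card_filter_mul_card_le {V ι : Type*} [Fintype (SimpleGraph V)]
    (P : SimpleGraph V → Prop) [DecidablePred P] (F : Finset ι) (H : ι → SimpleGraph V) (B : ℝ)
    (hB : ∀ G, ((F.filter fun f => P (G ∆ H f)).card : ℝ) ≤ B) :
    ((univ.filter P).card : ℝ) * F.card ≤ Fintype.card (SimpleGraph V) * B := by
  have h1 : ∀ f ∈ F, (univ.filter fun G => P (G ∆ H f)).card = (univ.filter P).card := by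
    intro f _
    refine Finset.card_bij' (fun G _ => G ∆ H f) (fun G _ => G ∆ H f) ?_ ?_ ?_ ?_ <;> simp
  have h2 := Finset.sum_card_bipartiteAbove_eq_sum_card_bipartiteBelow
    (s := F) (t := (univ : Finset (SimpleGraph V))) (fun f G => P (G ∆ H f))
  simp only [Finset.bipartiteAbove, Finset.bipartiteBelow] at h2
  rw [Finset.sum_congr rfl h1, Finset.sum_const, smul_eq_mul] at h2
  rw [mul_comm, ← Nat.cast_mul, h2, Nat.cast_sum]
  refine (Finset.sum_le_sum fun G _ => hB G).trans_eq ?_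
  simp

/-- The bipartite graph in which each `v ∈ S` is joined to the vertices of `f v` outside `S`. -/
def starGraph {V : Type*} (S : Finset V) (f : S → Finset V) : SimpleGraph V where
  Adj v w := (∃ h : v ∈ S, w ∉ S ∧ w ∈ f ⟨v, h⟩) ∨ ∃ h : w ∈ S, v ∉ S ∧ v ∈ f ⟨w, h⟩
  symm := ⟨fun _ _ h => h.symm⟩
  loopless := ⟨fun _ h => by
    rcases h with ⟨h, h', _⟩ | ⟨h, h', _⟩ <;> exact h' h⟩

theorem starGraph_adj {n : ℕ} {S : Finset (Fin n)} {f : S → Finset (Fin n)} (v : S)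
    (hf : f v ⊆ Sᶜ) (w : Fin n) : (starGraph S f).Adj v w ↔ w ∈ f v := by
  have h := @hf w
  have hv := v.2
  simp only [Finset.mem_compl] at h
  simp only [starGraph, Subtype.coe_eta]
  constructor
  · rintro (⟨_, _, h'⟩ | ⟨_, h', _⟩)
    · exact h'
    · exact absurd hv h'
  · exact fun h' => Or.inl ⟨hv, h h', h'⟩

theorem friendliness_of_mem {n : ℕ} (G : SimpleGraph (Fin n)) {A : Finset (Fin n)} {v : Fin n}
    (hv : v ∈ A) : friendliness G A v =
      ((univ.filter fun w => w ∈ A ↔ G.Adj v w).card : ℤ) - Aᶜ.card := by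
  have h1 := Finset.card_filter_add_card_filter_not (s := Aᶜ) (fun w => G.Adj v w)
  have h2 : (univ.filter fun w => w ∈ A ↔ G.Adj v w).card =
      (A.filter fun w => G.Adj v w).card + (Aᶜ.filter fun w => ¬ G.Adj v w).card := by
    rw [← Finset.card_union_of_disjoint]
    · congr 1
      ext w
      simp only [Finset.mem_filter, Finset.mem_union, Finset.mem_compl, Finset.mem_univ]
      tauto
    · rw [Finset.disjoint_left]
      intro w
      simp only [Finset.mem_filter, Finset.mem_compl]
      tauto
  simp only [friendliness, if_pos hv, degIn]
  omega

theorem friendliness_symmDiff_starGraph {n : ℕ} (G : SimpleGraph (Fin n)) {S A : Finset (Fin n)}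
    (hSA : S ⊆ A) {f : S → Finset (Fin n)} (v : S) (hf : f v ⊆ Sᶜ) :
    friendliness (G ∆ starGraph S f) A v =
      (((univ.filter fun w => w ∈ A ↔ G.Adj v w) ∆ f v).card : ℤ) - Aᶜ.card := by
  rw [friendliness_of_mem _ (hSA v.2)]
  congr 3
  ext w
  have h := starGraph_adj v hf w
  have h' : (G ∆ starGraph S f).Adj v w ↔
      (G.Adj v w ∧ ¬ (starGraph S f).Adj v w ∨ (starGraph S f).Adj v w ∧ ¬ G.Adj v w) := by
    simp [symmDiff]
  rw [h] at h'
  simp only [Finset.mem_filter, Finset.mem_univ, Finset.mem_symmDiff, h']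
  tauto

theorem friendliness_compl {n : ℕ} (G : SimpleGraph (Fin n)) (A : Finset (Fin n)) (v : Fin n) :
    friendliness G Aᶜ v = friendliness G A v := by
  by_cases h : v ∈ A <;> simp [friendliness, h]

theorem IsBisection.compl {n : ℕ} {A : Finset (Fin n)} (hA : IsBisection A) :
    IsBisection Aᶜ := by
  unfold IsBisection at *
  rwa [compl_compl, abs_sub_comm]

/-- The probability that all vertices of a fixed subset `S` of one part have small friendliness. -/
theorem card_filter_forall_friendliness_lt_le {n : ℕ} {A S : Finset (Fin n)} (hSA : S ⊆ A)
    (hA : IsBisection A) (ε : ℝ) (hε : 1 ≤ ε * √(n : ℝ)) :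
    ((univ.filter fun G => ∀ v ∈ S, |(friendliness G A v : ℝ)| < ε * √(n : ℝ)).card : ℝ) ≤
      Fintype.card (SimpleGraph (Fin n)) * (5 * ε) ^ S.card := by
  set L := ε * √(n : ℝ) with hL
  have hn : 0 < √(n : ℝ) := by
    rcases (Real.sqrt_nonneg (n : ℝ)).eq_or_lt with h | h
    · rw [hL, ← h] at hε
      norm_num at hε
    · exact h
  have hεpos : 0 < ε := by
    by_contra h
    nlinarith
  have hcard : (n : ℝ) ≤ 2 * ((Sᶜ.card : ℝ) + 1) := by
    have h1 := abs_le.1 hA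
    have h2 := Finset.card_le_card hSA
    have h3 := Finset.card_add_card_compl A
    have h4 := Finset.card_add_card_compl S
    rw [Fintype.card_fin] at h3 h4
    have : n ≤ 2 * (Sᶜ.card + 1) := by omega
    exact_mod_cast this
  have hsqrt : 3 * √(n : ℝ) ≤ 5 * √((Sᶜ.card : ℝ) + 1) := by
    refine abs_le_of_sq_le_sq' ?_ (by positivity) |>.2
    rw [mul_pow, mul_pow, Real.sq_sqrt (by positivity), Real.sq_sqrt (by positivity)]
    linarith
  have hpos : 0 < √((Sᶜ.card : ℝ) + 1) := by positivity
  have hone : ∀ X : Finset (Fin n),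
      ((Sᶜ.powerset.filter fun U => |((X ∆ U).card : ℝ) - Aᶜ.card| < L).card : ℝ) ≤
        5 * ε * 2 ^ Sᶜ.card := by
    intro X
    have h := card_filter_symmDiff_le Sᶜ X Aᶜ.card L hε
    refine le_of_mul_le_mul_right (h.trans ?_) hpos
    calc 3 * L * 2 ^ Sᶜ.card = (3 * √(n : ℝ)) * (ε * 2 ^ Sᶜ.card) := by rw [hL]; ring
      _ ≤ (5 * √((Sᶜ.card : ℝ) + 1)) * (ε * 2 ^ Sᶜ.card) := by gcongr
      _ = _ := by ring
  have hmain := card_filter_mul_card_le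
    (fun G : SimpleGraph (Fin n) => ∀ v ∈ S, |(friendliness G A v : ℝ)| < L)
    (Fintype.piFinset fun _ : S => Sᶜ.powerset) (starGraph S) ((5 * ε * 2 ^ Sᶜ.card) ^ S.card) ?_
  · have hF : ((Fintype.piFinset fun _ : S => Sᶜ.powerset).card : ℝ) =
        (2 ^ Sᶜ.card) ^ S.card := by
      simp [Fintype.card_piFinset]
    rw [hF, mul_pow, ← mul_assoc] at hmain
    refine le_of_mul_le_mul_right hmain ?_
    positivity
  · intro G
    refine (Nat.cast_le.2 (Finset.card_le_card
      (t := Fintype.piFinset fun v : S => Sᶜ.powerset.filter fun U =>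
        |(((univ.filter fun w => w ∈ A ↔ G.Adj v w) ∆ U).card : ℝ) - Aᶜ.card| < L) ?_)).trans ?_
    · intro f hf
      rw [Finset.mem_filter, Fintype.mem_piFinset] at hf
      rw [Fintype.mem_piFinset]
      intro v
      refine Finset.mem_filter.2 ⟨hf.1 v, ?_⟩
      have h := hf.2 v v.2
      rw [friendliness_symmDiff_starGraph G hSA v (Finset.mem_powerset.1 (hf.1 v))] at h
      push_cast at h
      exact h
    · rw [Fintype.card_piFinset, Nat.cast_prod]
      refine (Finset.prod_le_prod (fun _ _ => Nat.cast_nonneg _) fun v _ => hone _).trans_eq ?_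
      simp

theorem five_mul_four_rpow_pow_le {η : ℝ} (h0 : 0 < η) (h1 : η < 1 / 10) {n k : ℕ}
    (hk : η * n ≤ k) : (5 * (4 : ℝ) ^ (-1 / η)) ^ k ≤ (5 / 16) ^ n := by
  have h5 : (5 : ℝ) ^ η ≤ 5 / 4 := by
    calc (5 : ℝ) ^ η ≤ 5 ^ (1 / 10 : ℝ) := Real.rpow_le_rpow_of_exponent_le (by norm_num) h1.le
      _ ≤ ((5 / 4 : ℝ) ^ (10 : ℕ)) ^ (1 / 10 : ℝ) := by
          gcongr
          norm_num
      _ = 5 / 4 := by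
          rw [← Real.rpow_natCast, ← Real.rpow_mul (by norm_num)]
          norm_num
  have hle : 5 * (4 : ℝ) ^ (-1 / η) ≤ 1 := by
    have : (4 : ℝ) ^ (-1 / η) ≤ 4 ^ (-2 : ℝ) := by
      refine Real.rpow_le_rpow_of_exponent_le (by norm_num) ?_
      rw [div_le_iff₀ h0]
      linarith
    have h16 : (4 : ℝ) ^ (-2 : ℝ) = 1 / 16 := by
      rw [Real.rpow_neg (by norm_num)]
      norm_num
    linarith
  have hpos : 0 < 5 * (4 : ℝ) ^ (-1 / η) := by positivity
  rw [← Real.rpow_natCast]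
  calc (5 * (4 : ℝ) ^ (-1 / η)) ^ (k : ℝ) ≤ (5 * (4 : ℝ) ^ (-1 / η)) ^ (η * n) :=
        Real.rpow_le_rpow_of_exponent_ge hpos hle hk
    _ = (5 ^ η * 4⁻¹) ^ n := by
        rw [Real.rpow_mul hpos.le, Real.rpow_natCast, Real.mul_rpow (by norm_num) (by positivity),
          ← Real.rpow_mul (by norm_num), div_mul_cancel₀ _ h0.ne', Real.rpow_neg_one]
    _ ≤ (5 / 16) ^ n := by
        gcongr
        linarith

theorem graphProb_le_one (n : ℕ) (P : SimpleGraph (Fin n) → Prop) : graphProb n P ≤ 1 := by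
  refine div_le_one_of_le₀ ?_ (Nat.cast_nonneg _)
  exact_mod_cast Finset.card_le_univ _

theorem one_sub_le_graphProb {n : ℕ} {P : SimpleGraph (Fin n) → Prop} {δ : ℝ}
    (B : Finset (SimpleGraph (Fin n))) (hPB : ∀ G, ¬ P G → G ∈ B)
    (hB : (B.card : ℝ) ≤ Fintype.card (SimpleGraph (Fin n)) * δ) :
    1 - δ ≤ graphProb n P := by
  have hpos : (0 : ℝ) < Fintype.card (SimpleGraph (Fin n)) := by
    exact_mod_cast Fintype.card_pos
  have hsum : ((univ.filter P).card : ℝ) + (univ.filter fun G => ¬ P G).card =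
      Fintype.card (SimpleGraph (Fin n)) := by
    exact_mod_cast Finset.card_filter_add_card_filter_not (s := univ) P
  have hle : ((univ.filter fun G => ¬ P G).card : ℝ) ≤ B.card :=
    Nat.cast_le.2 (Finset.card_le_card fun G hG => hPB G (Finset.mem_filter.1 hG).2)
  rw [graphProb, le_div_iff₀ hpos]
  linarith

theorem sum_powerset_eq_three_pow (n : ℕ) (c : ℝ) :
    ∑ A : Finset (Fin n), ∑ _S ∈ A.powerset, c = 3 ^ n * c := by
  have h := Fintype.sum_pow_mul_eq_add_pow (Fin n) (2 : ℝ) 1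
  simp only [one_pow, mul_one, Fintype.card_fin] at h
  simp only [Finset.sum_const, Finset.card_powerset, nsmul_eq_mul, ← Finset.sum_mul]
  push_cast
  rw [h]
  norm_num

/-- there is `η₀ > 0` such that for every fixed `η ∈ (0,η₀)`, with high
probability, for every bisection `A ∪ Aᶜ` of `G(n,1/2)`, all but at most `ηn` vertices of
each part have `|Δ_{A,B}(v)| ≥ 4^{-1/η} √n`. -/
theorem statement4 :
    ∃ η₀ : ℝ, 0 < η₀ ∧ ∀ η : ℝ, 0 < η → η < η₀ →
      Tendsto (fun n : ℕ => graphProb n (fun G => ∀ A : Finset (Fin n), IsBisection A →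
          ((A.filter fun v =>
              |(friendliness G A v : ℝ)| < (4 : ℝ) ^ (-1 / η) * Real.sqrt n).card : ℝ) ≤ η * n ∧
          ((Aᶜ.filter fun v =>
              |(friendliness G A v : ℝ)| < (4 : ℝ) ^ (-1 / η) * Real.sqrt n).card : ℝ) ≤ η * n))
        atTop (nhds 1) := by
  refine ⟨1 / 10, by norm_num, fun η h0 h1 => ?_⟩
  set ε : ℝ := (4 : ℝ) ^ (-1 / η) with hε
  have hεpos : 0 < ε := by positivity
  have hlim : Tendsto (fun n : ℕ => 1 - (15 / 16 : ℝ) ^ n) atTop (nhds 1) := by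
    simpa using (tendsto_pow_atTop_nhds_zero_of_lt_one (by norm_num : (0 : ℝ) ≤ 15 / 16)
      (by norm_num)).const_sub 1
  refine tendsto_of_tendsto_of_tendsto_of_le_of_le' hlim tendsto_const_nhds ?_
    (Eventually.of_forall fun n => graphProb_le_one n _)
  have hlarge : ∀ᶠ n : ℕ in atTop, 1 ≤ ε * √(n : ℝ) :=
    ((Real.tendsto_sqrt_atTop.comp tendsto_natCast_atTop_atTop).const_mul_atTop
      hεpos).eventually_ge_atTop 1
  filter_upwards [hlarge] with n hn
  set E : Finset (Fin n) → Finset (Fin n) → Finset (SimpleGraph (Fin n)) := fun A S =>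
    if IsBisection A ∧ η * n ≤ S.card then
      univ.filter fun G => ∀ v ∈ S, |(friendliness G A v : ℝ)| < ε * √(n : ℝ) else ∅ with hE
  have hEcard : ∀ A : Finset (Fin n), ∀ S ∈ A.powerset,
      ((E A S).card : ℝ) ≤ Fintype.card (SimpleGraph (Fin n)) * (5 / 16) ^ n := by
    intro A S hS
    by_cases h : IsBisection A ∧ η * n ≤ S.card
    · simp only [hE, if_pos h]
      refine (card_filter_forall_friendliness_lt_le (Finset.mem_powerset.1 hS) h.1 ε hn).trans ?_
      gcongr
      exact five_mul_four_rpow_pow_le h0 h1 h.2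
    · simp only [hE, if_neg h, Finset.card_empty, Nat.cast_zero]
      positivity
  have hmem : ∀ (G : SimpleGraph (Fin n)) (A : Finset (Fin n)), IsBisection A →
      η * n < ((A.filter fun v => |(friendliness G A v : ℝ)| < ε * √(n : ℝ)).card : ℝ) →
      G ∈ univ.biUnion fun A : Finset (Fin n) => A.powerset.biUnion (E A) := by
    intro G A hA hlt
    simp only [Finset.mem_biUnion, Finset.mem_univ, true_and]
    refine ⟨A, A.filter fun v => |(friendliness G A v : ℝ)| < ε * √(n : ℝ),
      Finset.mem_powerset.2 (Finset.filter_subset _ _), ?_⟩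
    simp only [hE]
    rw [if_pos ⟨hA, hlt.le⟩]
    simp
  refine one_sub_le_graphProb
    (univ.biUnion fun A : Finset (Fin n) => A.powerset.biUnion (E A)) ?_ ?_
  · intro G hG
    obtain ⟨A, hG⟩ := not_forall.1 hG
    obtain ⟨hA, hG⟩ := Classical.not_imp.1 hG
    rcases not_and_or.1 hG with h | h
    · exact hmem G A hA (not_le.1 h)
    · refine hmem G Aᶜ hA.compl ?_
      simp only [friendliness_compl]
      exact not_le.1 h
  calc ((univ.biUnion fun A : Finset (Fin n) => A.powerset.biUnion (E A)).card : ℝ)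
      ≤ ((∑ A : Finset (Fin n), ∑ S ∈ A.powerset, (E A S).card : ℕ) : ℝ) :=
        Nat.cast_le.2 (Finset.card_biUnion_le.trans
          (Finset.sum_le_sum fun A _ => Finset.card_biUnion_le))
    _ ≤ ∑ A : Finset (Fin n), ∑ _S ∈ A.powerset,
          (Fintype.card (SimpleGraph (Fin n)) : ℝ) * (5 / 16) ^ n := by
        push_cast
        exact Finset.sum_le_sum fun A _ => Finset.sum_le_sum fun S hS => hEcard A S hS
    _ = Fintype.card (SimpleGraph (Fin n)) * (15 / 16) ^ n := by
        rw [sum_powerset_eq_three_pow, mul_left_comm, ← mul_pow]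
        norm_num
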